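/- arXiv:2506.03480 — 3 statements merged into one kernel-verified Lean document; each statement's English description precedes it below -/
import Mathlib

section
/- Every triangle-free finite graph $G$ with no isolated vertex and with independence number at most $3$ enjoys the strong exchange property: for every $\mathfrak{c} \in \mathbb{Z}_{>0}^{|V(G)|}$, the minimal set of monomial generators $\mathcal{W}(\mathfrak{c},G)$ of $(I(G)^{\delta_{\mathfrak{c}}(I(G))})_{\mathfrak{c}}$ enjoys the strong exchange property. -/
open Finset

/-- A monomial with exponent vector `a` belongs to the `q`-th power of the edge ideal of `G`:
it is divisible by a product of `q` edges of `G`. -/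
def memPow {n : ℕ} (G : SimpleGraph (Fin n)) (q : ℕ) (a : Fin n → ℕ) : Prop :=
  ∃ e : Fin q → Fin n × Fin n, (∀ i, G.Adj (e i).1 (e i).2) ∧
    ∀ j, (∑ i, ((if (e i).1 = j then 1 else 0) + (if (e i).2 = j then 1 else 0))) ≤ a j

/-- The exponent vector `a` is componentwise bounded by `c`. -/
def bdd {n : ℕ} (c a : Fin n → ℕ) : Prop := ∀ i, a i ≤ c i

/-- `δ_c(I(G))`: the largest `q` such that `(I(G)^q)_c ≠ 0`, i.e. such that some
`c`-bounded monomial lies in `I(G)^q`. -/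
noncomputable def deltaC {n : ℕ} (G : SimpleGraph (Fin n)) (c : Fin n → ℕ) : ℕ :=
  sSup {q | ∃ a, bdd c a ∧ memPow G q a}

/-- `W(c,G)`: the minimal monomial generators of `(I(G)^{δ_c(I(G))})_c`, i.e. the
`c`-bounded monomials of `I(G)^{δ_c}` that are minimal with respect to divisibility. -/
def genW {n : ℕ} (G : SimpleGraph (Fin n)) (c : Fin n → ℕ) : Set (Fin n → ℕ) :=
  {a | bdd c a ∧ memPow G (deltaC G c) a ∧
    ∀ b, bdd a b → memPow G (deltaC G c) b → b = a}

/-- The monomial `x_ρ · u / x_ξ`. -/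
def exch {n : ℕ} (u : Fin n → ℕ) (ξ ρ : Fin n) : Fin n → ℕ :=
  fun i => if i = ρ then u i + 1 else if i = ξ then u i - 1 else u i

/-- `W(c,G)` enjoys the strong exchange property. -/
def SEPc {n : ℕ} (G : SimpleGraph (Fin n)) (c : Fin n → ℕ) : Prop :=
  ∀ u ∈ genW G c, ∀ v ∈ genW G c, ∀ ξ ρ : Fin n, v ξ < u ξ → u ρ < v ρ →
    exch u ξ ρ ∈ genW G c

/-- The graph `G` enjoys the strong exchange property: `W(c,G)` does, for every
`c ∈ ℤ_{>0}^n`. -/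
def SEP {n : ℕ} (G : SimpleGraph (Fin n)) : Prop :=
  ∀ c : Fin n → ℕ, (∀ i, 0 < c i) → SEPc G c

/-- The cycle graph on `Fin m`. -/
def cycleG (m : ℕ) : SimpleGraph (Fin m) :=
  SimpleGraph.fromRel (fun i j => (i.val + 1) % m = j.val)

/-- The path graph on `Fin m`. -/
def pathG (m : ℕ) : SimpleGraph (Fin m) :=
  SimpleGraph.fromRel (fun i j => i.val + 1 = j.val)

/-- A set of monomials is of Veronese type: it equals `w · V^{(d)}(a)`, the set of
translates by a fixed monomial `w` of all monomials of degree `d` componentwise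
bounded by `a`. -/
def IsVeronese {n : ℕ} (S : Set (Fin n → ℕ)) : Prop :=
  ∃ (w : Fin n → ℕ) (d : ℕ) (a : Fin n → ℕ), d ≤ ∑ i, a i ∧
    S = {u | ∃ v : Fin n → ℕ, (∀ i, v i ≤ a i) ∧ (∑ i, v i) = d ∧
      u = fun i => w i + v i}

/-- The graph on `Fin m` with edges given by a list of (0-based) pairs. -/
def listGraph (m : ℕ) (E : List (ℕ × ℕ)) : SimpleGraph (Fin m) :=
  SimpleGraph.fromRel (fun i j => (i.val, j.val) ∈ E)

/-- `w` is obtained from `u` by moving one unit from `ξ` to `ρ`. -/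
def IsExchange {n : ℕ} (w u : Fin n → ℕ) (ξ ρ : Fin n) : Prop :=
  ∀ i, w i + (if i = ξ then 1 else 0) = u i + (if i = ρ then 1 else 0)

/-- The exchange property of (integral) polymatroid bases. -/
def HasExchange {n : ℕ} (W : Set (Fin n → ℕ)) : Prop :=
  ∀ u ∈ W, ∀ v ∈ W, ∀ ρ, u ρ < v ρ → ∃ ξ, v ξ < u ξ ∧ ∃ w ∈ W, IsExchange w u ξ ρ

/-- Some member of `W` lies strictly below the bound `c` at both `i` and `j`. -/
def CoDeficient {n : ℕ} (W : Set (Fin n → ℕ)) (c : Fin n → ℕ) (i j : Fin n) : Prop :=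
  ∃ w ∈ W, w i < c i ∧ w j < c j

theorem CoDeficient.symm {n : ℕ} {W : Set (Fin n → ℕ)} {c : Fin n → ℕ} {i j : Fin n}
    (h : CoDeficient W c i j) : CoDeficient W c j i := by
  obtain ⟨w, hw, h1, h2⟩ := h
  exact ⟨w, hw, h2, h1⟩

theorem CoDeficient.left {n : ℕ} {W : Set (Fin n → ℕ)} {c : Fin n → ℕ} {i j : Fin n}
    (h : CoDeficient W c i j) : CoDeficient W c i i := by
  obtain ⟨w, hw, h1, -⟩ := h
  exact ⟨w, hw, h1, h1⟩

theorem CoDeficient.right {n : ℕ} {W : Set (Fin n → ℕ)} {c : Fin n → ℕ} {i j : Fin n}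
    (h : CoDeficient W c i j) : CoDeficient W c j j := h.symm.left

/-- The dual form of the exchange property. -/
theorem HasExchange.dual {n : ℕ} {W : Set (Fin n → ℕ)} (hW : HasExchange W) {v : Fin n → ℕ}
    (hv : v ∈ W) : ∀ (k : ℕ) (u : Fin n → ℕ), u ∈ W → ∑ i, (v i - u i) ≤ k → ∀ ξ, v ξ < u ξ →
      ∃ ρ, u ρ < v ρ ∧ ∃ w ∈ W, IsExchange w u ξ ρ := by
  intro k
  induction k with
  | zero =>
    intro u hu hk ξ hξ
    obtain ⟨ρ, hρ, -⟩ := hW v hv u hu ξ hξ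
    have := Finset.single_le_sum (f := fun i => v i - u i) (fun _ _ => Nat.zero_le _)
      (Finset.mem_univ ρ)
    omega
  | succ k ih =>
    intro u hu hk ξ hξ
    obtain ⟨ρ, hρ, -⟩ := hW v hv u hu ξ hξ
    obtain ⟨ξ', hξ', u₁, hu₁, he₁⟩ := hW u hu v hv ρ hρ
    by_cases hne : ξ' = ξ
    · subst hne
      exact ⟨ρ, hρ, u₁, hu₁, he₁⟩
    have hlt : ∑ i, (v i - u₁ i) < ∑ i, (v i - u i) := by
      apply Finset.sum_lt_sum
      · intro i _
        have := he₁ i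
        grind
      · refine ⟨ρ, Finset.mem_univ _, ?_⟩
        have := he₁ ρ
        grind
    have hξ₁ : v ξ < u₁ ξ := by
      have := he₁ ξ
      grind
    obtain ⟨ρ', hρ', w, hw, he₂⟩ := ih u₁ hu₁ (by omega) ξ hξ₁
    have hlt' : w ξ' < u ξ' := by
      have := he₁ ξ'
      have := he₂ ξ'
      grind
    obtain ⟨σ, hσ, z, hz, he₃⟩ := hW w hw u hu ξ' hlt'
    have hσ' : σ = ρ ∨ σ = ρ' := by
      have := he₁ σ
      have := he₂ σ
      grind
    have hρu : u ρ' < v ρ' := by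
      have := he₁ ρ'
      have := he₁ ξ'
      grind
    rcases hσ' with rfl | rfl
    · refine ⟨ρ', hρu, z, hz, fun i => ?_⟩
      have := he₁ i
      have := he₂ i
      have := he₃ i
      omega
    · refine ⟨ρ, hρ, z, hz, fun i => ?_⟩
      have := he₁ i
      have := he₂ i
      have := he₃ i
      omega

theorem HasExchange.exists_dual {n : ℕ} {W : Set (Fin n → ℕ)} (hW : HasExchange W)
    {u v : Fin n → ℕ} (hu : u ∈ W) (hv : v ∈ W) {ξ : Fin n} (hξ : v ξ < u ξ) :
    ∃ ρ, u ρ < v ρ ∧ ∃ w ∈ W, IsExchange w u ξ ρ :=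
  hW.dual hv _ u hu le_rfl ξ hξ

/-- Two positions that are never deficient simultaneously can be exchanged. -/
theorem HasExchange.of_not_coDeficient {n : ℕ} {W : Set (Fin n → ℕ)} (hW : HasExchange W)
    {c u v : Fin n → ℕ} (hb : ∀ w ∈ W, bdd c w) (hu : u ∈ W) (hv : v ∈ W) {ξ ρ : Fin n}
    (hξ : v ξ < u ξ) (hρ : u ρ < v ρ) (hno : ¬ CoDeficient W c ξ ρ) :
    ∃ w ∈ W, IsExchange w u ξ ρ := by
  obtain ⟨σ, hσ, w, hw, he⟩ := hW.exists_dual hu hv hξ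
  by_cases h : σ = ρ
  · exact ⟨w, hw, h ▸ he⟩
  refine absurd ⟨w, hw, ?_, ?_⟩ hno
  · have := he ξ
    have := hb u hu ξ
    grind
  · have := he ρ
    have := hb v hv ρ
    grind

/-- Never being simultaneously deficient is a transitive relation. -/
theorem HasExchange.coDeficient_or {n : ℕ} {W : Set (Fin n → ℕ)} (hW : HasExchange W)
    {c : Fin n → ℕ} (hb : ∀ w ∈ W, bdd c w) {x y z : Fin n} (hxz : x ≠ z)
    (h : CoDeficient W c x z) (hy : CoDeficient W c y y) :
    CoDeficient W c x y ∨ CoDeficient W c y z := by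
  obtain ⟨w, hw, hx, hz⟩ := h
  obtain ⟨v, hv, hvy, -⟩ := hy
  by_cases hwy : w y < c y
  · exact Or.inl ⟨w, hw, hx, hwy⟩
  obtain ⟨σ, hσ, w', hw', he⟩ := hW.exists_dual hw hv (ξ := y) (by omega)
  have h1 : w' y < c y := by
    have := he y
    have := hb w hw y
    grind
  by_cases h : σ = x
  · refine Or.inr ⟨w', hw', h1, ?_⟩
    have := he z
    grind
  · refine Or.inl ⟨w', hw', ?_, h1⟩
    have := he x
    grind

/-- Symmetric matrices of edge multiplicities supported on the edges of `G`. -/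
def IsMultigraph {n : ℕ} (G : SimpleGraph (Fin n)) (M : Fin n → Fin n → ℕ) : Prop :=
  (∀ i j, M i j = M j i) ∧ ∀ i j, M i j ≠ 0 → G.Adj i j

/-- The multiplicity matrix of a single edge. -/
def edgeMatrix {n : ℕ} (x y : Fin n) : Fin n → Fin n → ℕ :=
  fun i j => (if x = i ∧ y = j then 1 else 0) + (if y = i ∧ x = j then 1 else 0)

theorem sum_edgeMatrix {n : ℕ} (x y i : Fin n) :
    ∑ j, edgeMatrix x y i j = (if x = i then 1 else 0) + (if y = i then 1 else 0) := by
  simp only [edgeMatrix, Finset.sum_add_distrib, ite_and]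
  congr 1
  · by_cases h : x = i <;> simp [h]
  · by_cases h : y = i <;> simp [h]

theorem isMultigraph_edgeMatrix {n : ℕ} {G : SimpleGraph (Fin n)} {x y : Fin n}
    (h : G.Adj x y) : IsMultigraph G (edgeMatrix x y) := by
  have h' := h.symm
  constructor
  · intro i j
    simp only [edgeMatrix]
    grind
  · intro i j
    simp only [edgeMatrix]
    grind

theorem IsMultigraph.add_edge {n : ℕ} {G : SimpleGraph (Fin n)} {M : Fin n → Fin n → ℕ}
    (hM : IsMultigraph G M) {x y : Fin n} (h : G.Adj x y) :
    IsMultigraph G (fun i j => M i j + edgeMatrix x y i j) := by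
  obtain ⟨h1, h2⟩ := isMultigraph_edgeMatrix h
  refine ⟨fun i j => ?_, fun i j hij => ?_⟩
  · simp only [hM.1 i j, h1 i j]
  · by_cases h0 : M i j = 0
    · simp only at hij
      exact h2 i j (by omega)
    · exact hM.2 i j h0

theorem IsMultigraph.remove_edge {n : ℕ} {G : SimpleGraph (Fin n)} {M : Fin n → Fin n → ℕ}
    (hM : IsMultigraph G M) {x y : Fin n} (h : M x y ≠ 0) :
    ∃ M₀, IsMultigraph G M₀ ∧ ∀ i j, M i j = M₀ i j + edgeMatrix x y i j := by
  have hxy := hM.2 x y h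
  have hne := hxy.ne
  obtain ⟨h1, h2⟩ := isMultigraph_edgeMatrix hxy
  refine ⟨fun i j => M i j - edgeMatrix x y i j, ⟨fun i j => ?_, fun i j hij => ?_⟩,
    fun i j => ?_⟩
  · simp only [hM.1 i j, h1 i j]
  · simp only at hij
    exact hM.2 i j (by omega)
  · have := hM.1 x y
    simp only [edgeMatrix]
    grind

theorem sum_add_edge {n : ℕ} (M : Fin n → Fin n → ℕ) (x y i : Fin n) :
    ∑ j, (M i j + edgeMatrix x y i j) =
      ∑ j, M i j + ((if x = i then 1 else 0) + (if y = i then 1 else 0)) := by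
  rw [Finset.sum_add_distrib, sum_edgeMatrix]

/-- `a` is the degree vector of a multigraph with `q` edges, all of them edges of `G`. -/
def IsDegree {n : ℕ} (G : SimpleGraph (Fin n)) (q : ℕ) (a : Fin n → ℕ) : Prop :=
  ∃ M, IsMultigraph G M ∧ (∀ i, ∑ j, M i j = a i) ∧ ∑ i, a i = 2 * q

theorem memPow.exists_isDegree {n : ℕ} {G : SimpleGraph (Fin n)} {q : ℕ} {b : Fin n → ℕ}
    (h : memPow G q b) : ∃ a, bdd b a ∧ IsDegree G q a := by
  obtain ⟨e, he, hb⟩ := h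
  refine ⟨_, hb, fun i j => ∑ k, edgeMatrix (e k).1 (e k).2 i j, ⟨fun i j => ?_, fun i j hij => ?_⟩,
    fun i => ?_, ?_⟩
  · exact Finset.sum_congr rfl fun k _ => (isMultigraph_edgeMatrix (he k)).1 i j
  · obtain ⟨k, -, hk⟩ := Finset.exists_ne_zero_of_sum_ne_zero hij
    exact (isMultigraph_edgeMatrix (he k)).2 i j hk
  · rw [Finset.sum_comm]
    exact Finset.sum_congr rfl fun k _ => sum_edgeMatrix _ _ _
  · rw [Finset.sum_comm]
    simp [Finset.sum_add_distrib]
    omega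

theorem IsDegree.memPow {n : ℕ} {G : SimpleGraph (Fin n)} {q : ℕ} {a : Fin n → ℕ}
    (h : IsDegree G q a) : memPow G q a := by
  induction q generalizing a with
  | zero => exact ⟨Fin.elim0, fun i => i.elim0, fun j => by simp⟩
  | succ q ih =>
    obtain ⟨M, hM, hd, hs⟩ := h
    have : ∃ x y, M x y ≠ 0 := by
      by_contra! h0
      simp only [h0, Finset.sum_const_zero] at hd
      simp only [← hd, Finset.sum_const_zero] at hs
      omega
    obtain ⟨x, y, hxy⟩ := this
    obtain ⟨M₀, hM₀, he⟩ := hM.remove_edge hxy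
    have hd' : ∀ i, a i = ∑ j, M₀ i j + ((if x = i then 1 else 0) + (if y = i then 1 else 0)) := by
      intro i
      rw [← hd i, ← sum_add_edge]
      exact Finset.sum_congr rfl fun j _ => he i j
    obtain ⟨e, h1, h2⟩ := ih (a := fun i => ∑ j, M₀ i j) ⟨M₀, hM₀, fun _ => rfl, by
      simp only [hd', Finset.sum_add_distrib, Finset.sum_ite_eq, Finset.mem_univ, if_true] at hs
      show ∑ i, ∑ j, M₀ i j = 2 * q
      omega⟩
    refine ⟨Fin.cons (x, y) e, fun i => ?_, fun j => ?_⟩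
    · refine Fin.cases ?_ (fun k => ?_) i
      · exact hM.2 x y hxy
      · exact h1 k
    · rw [Fin.sum_univ_succ]
      have := h2 j
      simp only [Fin.cons_zero, Fin.cons_succ, hd' j] at this ⊢
      omega

theorem IsDegree.le_deltaC {n : ℕ} {G : SimpleGraph (Fin n)} {q : ℕ} {a c : Fin n → ℕ}
    (h : IsDegree G q a) (hc : bdd c a) : q ≤ deltaC G c := by
  refine le_csSup ⟨∑ i, c i, ?_⟩ ⟨a, hc, h.memPow⟩
  rintro q' ⟨b, hb, hm⟩
  obtain ⟨a', ha', -, -, -, hs⟩ := hm.exists_isDegree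
  have : ∑ i, a' i ≤ ∑ i, c i := Finset.sum_le_sum fun i _ => (ha' i).trans (hb i)
  omega

theorem mem_genW_iff {n : ℕ} {G : SimpleGraph (Fin n)} {c u : Fin n → ℕ} :
    u ∈ genW G c ↔ bdd c u ∧ IsDegree G (deltaC G c) u := by
  constructor
  · rintro ⟨hb, hm, hmin⟩
    obtain ⟨a, ha, hd⟩ := hm.exists_isDegree
    rw [hmin a ha hd.memPow] at hd
    exact ⟨hb, hd⟩
  · rintro ⟨hb, hd⟩
    refine ⟨hb, hd.memPow, fun b hbu hm => ?_⟩
    obtain ⟨a, ha, -, -, -, hs⟩ := hm.exists_isDegree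
    obtain ⟨-, -, -, hs'⟩ := hd
    have hau : ∀ i, a i = u i := by
      have := (Finset.sum_eq_sum_iff_of_le (s := Finset.univ) (f := a) (g := u)
        fun i _ => (ha i).trans (hbu i)).1 (hs.trans hs'.symm)
      simpa using this
    funext i
    have := ha i
    have := hbu i
    have := hau i
    omega

theorem not_coDeficient_of_adj {n : ℕ} {G : SimpleGraph (Fin n)} {c : Fin n → ℕ} {x y : Fin n}
    (h : G.Adj x y) : ¬ CoDeficient (genW G c) c x y := by
  rintro ⟨w, hw, hx, hy⟩
  obtain ⟨hb, M, hM, hd, hs⟩ := mem_genW_iff.1 hw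
  have hne := h.ne
  have hdeg : IsDegree G (deltaC G c + 1)
      (fun i => w i + ((if x = i then 1 else 0) + (if y = i then 1 else 0))) := by
    refine ⟨_, hM.add_edge h, fun i => ?_, ?_⟩
    · rw [sum_add_edge, hd i]
    · simp only [Finset.sum_add_distrib, hs, Finset.sum_ite_eq, Finset.mem_univ, if_true]
      omega
  have := hdeg.le_deltaC (c := c) (by
    intro i
    have := hb i
    grind)
  omega

/-- Replacing an edge `a b` by an edge `a r`. -/
theorem IsMultigraph.exists_swap {n : ℕ} {G : SimpleGraph (Fin n)} {M : Fin n → Fin n → ℕ}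
    (hM : IsMultigraph G M) {a b r : Fin n} (hab : M a b ≠ 0) (har : G.Adj a r) :
    ∃ M', IsMultigraph G M' ∧
      (∀ i j, M' i j + edgeMatrix a b i j = M i j + edgeMatrix a r i j) ∧
      IsExchange (fun i => ∑ j, M' i j) (fun i => ∑ j, M i j) b r := by
  obtain ⟨M₀, hM₀, he⟩ := hM.remove_edge hab
  refine ⟨_, hM₀.add_edge har, fun i j => ?_, fun i => ?_⟩
  · rw [he i j]
    omega
  · have h1 : ∑ j, M i j = _ := (Finset.sum_congr rfl fun j _ => he i j).trans (sum_add_edge _ _ _ i)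
    simp only [h1, sum_add_edge]
    grind

theorem IsExchange.sum_eq {n : ℕ} {w u : Fin n → ℕ} {ξ ρ : Fin n} (h : IsExchange w u ξ ρ) :
    ∑ i, w i = ∑ i, u i := by
  have := Finset.sum_congr rfl fun i (_ : i ∈ Finset.univ) => h i
  simpa [Finset.sum_add_distrib] using this

theorem hasExchange_genW {n : ℕ} (G : SimpleGraph (Fin n)) (c : Fin n → ℕ) :
    HasExchange (genW G c) := by
  intro u hu v hv ρ hρ
  obtain ⟨hvb, N, hN, hdN, -⟩ := mem_genW_iff.1 hv
  obtain ⟨-, M, hM, hdM, -⟩ := mem_genW_iff.1 hu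
  induction hk : ∑ i, ∑ j, (N i j - M i j) using Nat.strong_induction_on generalizing u M ρ with
  | _ k ih =>
  subst hk
  obtain ⟨hub, -, -, -, hsu⟩ := mem_genW_iff.1 hu
  obtain ⟨a, -, ha⟩ : ∃ a ∈ Finset.univ, M ρ a < N ρ a :=
    Finset.exists_lt_of_sum_lt (by rw [hdM, hdN]; exact hρ)
  have hadj : G.Adj a ρ := (hN.2 ρ a (by omega)).symm
  have hua : v a ≤ u a := by
    by_contra! hlt
    exact not_coDeficient_of_adj hadj ⟨u, hu, hlt.trans_le (hvb a), hρ.trans_le (hvb ρ)⟩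
  obtain ⟨b, hb⟩ : ∃ b, N a b < M a b := by
    by_contra! hle
    have : ∑ j, M a j < ∑ j, N a j := Finset.sum_lt_sum (fun j _ => hle j)
      ⟨ρ, Finset.mem_univ _, by rw [hM.1, hN.1 a ρ]; exact ha⟩
    rw [hdM, hdN] at this
    omega
  have hbρ : b ≠ ρ := by
    rintro rfl
    rw [hM.1, hN.1 a b] at hb
    omega
  obtain ⟨M', hM', hswap, hex⟩ := hM.exists_swap (a := a) (b := b) (r := ρ) (by omega) hadj
  simp only [hdM] at hex
  have hu' : (fun i => ∑ j, M' i j) ∈ genW G c := by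
    refine mem_genW_iff.2 ⟨fun i => ?_, M', hM', fun _ => rfl, hex.sum_eq.trans hsu⟩
    have := hex i
    have := hub i
    have := hvb ρ
    simp only at *
    grind
  by_cases hbv : v b < u b
  · exact ⟨b, hbv, _, hu', hex⟩
  have hlt : ∑ i, ∑ j, (N i j - M' i j) < ∑ i, ∑ j, (N i j - M i j) := by
    have hle : ∀ i j, N i j - M' i j ≤ N i j - M i j := by
      intro i j
      have := hswap i j
      have h1 := hM.1 a b
      have h2 := hN.1 a b
      simp only [edgeMatrix] at this
      have := hadj.ne
      have := (hM.2 a b (by omega)).ne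
      clear ih hu' hex hdM hdN
      grind
    refine Finset.sum_lt_sum (fun i _ => Finset.sum_le_sum fun j _ => hle i j)
      ⟨ρ, Finset.mem_univ _, Finset.sum_lt_sum (fun j _ => hle ρ j) ⟨a, Finset.mem_univ _, ?_⟩⟩
    have := hswap ρ a
    simp only [edgeMatrix] at this
    have := hadj.ne
    grind
  have hb' := hex b
  have hρ' := hex ρ
  simp only [if_true, hbρ, hbρ.symm, if_false] at hb' hρ'
  obtain ⟨ξ, hξ, w, hw, hwex⟩ := ih _ hlt _ hu' b (by omega) M' hM' (fun _ => rfl) rfl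
  refine ⟨ξ, ?_, w, hw, fun i => ?_⟩
  · have := hex ξ
    simp only at *
    grind
  · have := hex i
    have := hwex i
    simp only at *
    omega

theorem SimpleGraph.CliqueFree.not_adj_of_common_neighbor {V : Type*} {G : SimpleGraph V}
    (htf : G.CliqueFree 3) {x y z : V} (hx : G.Adj y x) (hz : G.Adj y z) : ¬ G.Adj x z := by
  classical
  intro h
  exact htf {y, x, z} (SimpleGraph.is3Clique_triple_iff.2 ⟨hx, hz, h⟩)

/-- If all neighbours of `y` in a maximum multigraph missing `x` are equal to `x`, then `y` has
smaller capacity than `x`; otherwise some other neighbour of `y` can be missed. -/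
theorem exists_deficient_neighbor {n : ℕ} {G : SimpleGraph (Fin n)} {c : Fin n → ℕ}
    {x y : Fin n} (hxy : G.Adj x y) (hx : CoDeficient (genW G c) c x x) :
    c y < c x ∨ ∃ z, z ≠ x ∧ G.Adj y z ∧ CoDeficient (genW G c) c z z := by
  obtain ⟨w, hw, hwx, -⟩ := hx
  obtain ⟨hb, M, hM, hd, hs⟩ := mem_genW_iff.1 hw
  by_cases h : ∃ z, z ≠ x ∧ M y z ≠ 0
  · obtain ⟨z, hzx, hz⟩ := h
    right
    refine ⟨z, hzx, hM.2 y z hz, ?_⟩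
    obtain ⟨M', hM', -, hex⟩ := hM.exists_swap hz hxy.symm
    simp only [hd] at hex
    have hlt : ∑ j, M' z j < c z := by
      have := hex z
      have := hb z
      simp only at *
      grind
    refine ⟨_, mem_genW_iff.2 ⟨fun i => ?_, M', hM', fun _ => rfl, hex.sum_eq.trans hs⟩, hlt, hlt⟩
    have := hex i
    have := hb i
    simp only at *
    grind
  · left
    push Not at h
    have h1 : w y = M y x := by
      rw [← hd y]
      exact Finset.sum_eq_single x (fun z _ hz => h z hz) (by simp)
    have h2 : M x y ≤ w x := by
      rw [← hd x]
      exact Finset.single_le_sum (f := fun j => M x j) (fun _ _ => Nat.zero_le _)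
        (Finset.mem_univ y)
    have h3 : ¬ w y < c y := fun h3 => not_coDeficient_of_adj hxy ⟨w, hw, hwx, h3⟩
    rw [hM.1] at h1
    omega

/-- A pair of deficient vertices can be replaced by a non-adjacent pair in the same classes. -/
theorem exists_nonadjacent_pair {n : ℕ} {G : SimpleGraph (Fin n)} (htf : G.CliqueFree 3)
    {c : Fin n → ℕ} {x y : Fin n} (hne : x ≠ y) (hx : CoDeficient (genW G c) c x x)
    (hy : CoDeficient (genW G c) c y y) :
    ∃ a b, a ≠ b ∧ ¬ G.Adj a b ∧ ∀ t, t ≠ x → t ≠ y → CoDeficient (genW G c) c t x →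
      CoDeficient (genW G c) c t y →
      (t ≠ a ∧ CoDeficient (genW G c) c t a) ∧ (t ≠ b ∧ CoDeficient (genW G c) c t b) := by
  by_cases hadj : G.Adj x y
  swap
  · exact ⟨x, y, hne, hadj, fun t h1 h2 h3 h4 => ⟨⟨h1, h3⟩, h2, h4⟩⟩
  have key : ∀ s p, G.Adj s p → CoDeficient (genW G c) c p p → ∀ t, t ≠ s →
      CoDeficient (genW G c) c t s → t ≠ p ∧ CoDeficient (genW G c) c t p := by
    intro s p hsp hp t hts hC
    constructor
    · rintro rfl
      exact not_coDeficient_of_adj hsp.symm hC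
    · exact ((hasExchange_genW G c).coDeficient_or (fun w hw => hw.1) hts hC hp).resolve_right
        (not_coDeficient_of_adj hsp.symm)
  rcases exists_deficient_neighbor hadj hx with h1 | ⟨z, hzx, hyz, hz⟩
  · rcases exists_deficient_neighbor hadj.symm hy with h2 | ⟨z, hzy, hxz, hz⟩
    · omega
    · exact ⟨y, z, hzy.symm, htf.not_adj_of_common_neighbor hadj hxz, fun t h1 _ h3 _ =>
        ⟨key x y hadj hy t h1 h3, key x z hxz hz t h1 h3⟩⟩
  · exact ⟨x, z, hzx.symm, htf.not_adj_of_common_neighbor hadj.symm hyz, fun t _ h2 _ h4 =>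
      ⟨key y x hadj.symm hx t h2 h4, key y z hyz hz t h2 h4⟩⟩

theorem false_of_two_pairs {n : ℕ} {G : SimpleGraph (Fin n)} (htf : G.CliqueFree 3)
    (hind : ∀ s : Finset (Fin n), (∀ i ∈ s, ∀ j ∈ s, ¬ G.Adj i j) → s.card ≤ 3)
    {c : Fin n → ℕ} {x y z t : Fin n} (hxy : x ≠ y) (hzt : z ≠ t)
    (hxz' : x ≠ z) (hxt' : x ≠ t) (hyz' : y ≠ z) (hyt' : y ≠ t)
    (hxz : CoDeficient (genW G c) c x z) (hxt : CoDeficient (genW G c) c x t)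
    (hyz : CoDeficient (genW G c) c y z) (hyt : CoDeficient (genW G c) c y t) : False := by
  obtain ⟨a, b, hab, habn, h⟩ := exists_nonadjacent_pair htf hxy hxz.left hyz.left
  obtain ⟨p, q, hpq, hpqn, h'⟩ := exists_nonadjacent_pair htf hzt hxz.right hxt.right
  obtain ⟨⟨hza, hza'⟩, hzb, hzb'⟩ := h z hxz'.symm hyz'.symm hxz.symm hyz.symm
  obtain ⟨⟨hta, hta'⟩, htb, htb'⟩ := h t hxt'.symm hyt'.symm hxt.symm hyt.symm
  obtain ⟨⟨hap, hap'⟩, haq, haq'⟩ := h' a hza.symm hta.symm hza'.symm hta'.symm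
  obtain ⟨⟨hbp, hbp'⟩, hbq, hbq'⟩ := h' b hzb.symm htb.symm hzb'.symm htb'.symm
  have nadj : ∀ i j, CoDeficient (genW G c) c i j → ¬ G.Adj i j :=
    fun i j hC hadj => not_coDeficient_of_adj hadj hC
  have h1 := nadj _ _ hap'
  have h2 := nadj _ _ haq'
  have h3 := nadj _ _ hbp'
  have h4 := nadj _ _ hbq'
  have hcard : ({a, b, p, q} : Finset (Fin n)).card = 4 := by
    simp [Finset.card_insert_of_notMem, hab, hap, haq, hbp, hbq, hpq]
  have := hind {a, b, p, q} (by
    simp only [Finset.mem_insert, Finset.mem_singleton]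
    rintro i (rfl | rfl | rfl | rfl) j (rfl | rfl | rfl | rfl) <;>
      first
        | exact G.loopless.irrefl _
        | assumption
        | (intro hc; have hc := hc.symm; contradiction))
  omega

/-- Every triangle-free finite graph with no isolated vertex and with
independence number at most 3 enjoys the strong exchange property. -/
theorem stmt5 (n : ℕ) (G : SimpleGraph (Fin n)) (htf : G.CliqueFree 3)
    (hiso : ∀ i, ∃ j, G.Adj i j)
    (hind : ∀ s : Finset (Fin n), (∀ i ∈ s, ∀ j ∈ s, ¬ G.Adj i j) → s.card ≤ 3) :
    SEP G := by
  intro c _ u hu v hv ξ ρ hξ hρ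
  have hW := hasExchange_genW G c
  have hbd : ∀ w ∈ genW G c, bdd c w := fun w hw => hw.1
  have hne : ξ ≠ ρ := by
    rintro rfl
    omega
  suffices h : ∃ w ∈ genW G c, IsExchange w u ξ ρ by
    obtain ⟨w, hw, he⟩ := h
    have : w = exch u ξ ρ := by
      funext i
      have := he i
      simp only [exch]
      grind
    exact this ▸ hw
  by_contra hno
  have hξρ : CoDeficient (genW G c) c ξ ρ := by
    by_contra hC
    exact hno (hW.of_not_coDeficient hbd hu hv hξ hρ hC)
  obtain ⟨ξ', hξ', w, hw, he⟩ := hW u hu v hv ρ hρ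
  obtain ⟨ρ', hρ', w', hw', he'⟩ := hW.exists_dual hu hv hξ
  have hξξ : ξ ≠ ξ' := by
    rintro rfl
    exact hno ⟨w, hw, he⟩
  have hρρ : ρ ≠ ρ' := by
    rintro rfl
    exact hno ⟨w', hw', he'⟩
  have h1 : ξ ≠ ρ' := by
    rintro rfl
    omega
  have h2 : ξ' ≠ ρ := by
    rintro rfl
    omega
  have h3 : ξ' ≠ ρ' := by
    rintro rfl
    omega
  have hCξ : CoDeficient (genW G c) c ξ ξ' :=
    ⟨v, hv, hξ.trans_le (hu.1 ξ), hξ'.trans_le (hu.1 ξ')⟩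
  have hCρ : CoDeficient (genW G c) c ρ ρ' :=
    ⟨u, hu, hρ.trans_le (hv.1 ρ), hρ'.trans_le (hv.1 ρ')⟩
  by_cases hC : CoDeficient (genW G c) c ξ' ρ'
  · exact false_of_two_pairs htf hind h1 h2 hξξ hne h3.symm hρρ.symm hCξ hξρ hC.symm hCρ.symm
  · have h4 := (hW.coDeficient_or hbd hξξ hCξ hCρ.right).resolve_right fun h => hC h.symm
    have h5 := (hW.coDeficient_or hbd hρρ hCρ hCξ.right).resolve_right hC
    exact false_of_two_pairs htf hind hne h3 hξξ h1 h2.symm hρρ hCξ h4 h5 hCρ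
end

section
/- The cycle $C_n$ with $n \geq 3$ enjoys the strong exchange property if and only if $3 \leq n \leq 7$. -/
open Finset

/-- The degree at `j` of the multiset of edges of the cycle in which the edge `{i, i + 1}` has
multiplicity `m i`. -/
def edgeDeg {n : ℕ} [NeZero n] (m : Fin n → ℕ) (j : Fin n) : ℕ := m (j - 1) + m j

/-- `a` is a multiset of edges of the cycle of maximal size among those with degrees bounded
by `c`. -/
def IsOpt {n : ℕ} [NeZero n] (c a : Fin n → ℕ) : Prop :=
  (∀ j, edgeDeg a j ≤ c j) ∧
    ∀ m : Fin n → ℕ, (∀ j, edgeDeg m j ≤ c j) → ∑ i, m i ≤ ∑ i, a i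

theorem IsOpt.shift {n : ℕ} [NeZero n] {c a : Fin n → ℕ} (h : IsOpt c a) (k : Fin n) :
    IsOpt (fun j => c (j + k)) (fun j => a (j + k)) := by
  refine ⟨fun j => ?_, fun m hm => ?_⟩
  · have := h.1 (j + k)
    rwa [edgeDeg, show j + k - 1 = j - 1 + k by abel] at this
  · have := h.2 (fun j => m (j - k)) fun j => by
      have := hm (j - k)
      simpa only [edgeDeg, show j - k - 1 = j - 1 - k by abel, sub_add_cancel] using this
    rw [show ∑ i, m (i - k) = ∑ i, m i from Equiv.sum_comp (Equiv.subRight k) m] at this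
    rwa [show ∑ i, a (i + k) = ∑ i, a i from Equiv.sum_comp (Equiv.addRight k) a]

theorem IsOpt.reflect {n : ℕ} [NeZero n] {c a : Fin n → ℕ} (h : IsOpt c a) :
    IsOpt (fun j => c (-j)) (fun j => a (-1 - j)) := by
  have e : ∀ m : Fin n → ℕ, ∑ i, m (-1 - i) = ∑ i, m i := fun m =>
    Equiv.sum_comp (Equiv.subLeft (-1)) m
  refine ⟨fun j => ?_, fun m hm => ?_⟩
  · have := h.1 (-j)
    simp only [edgeDeg] at this ⊢
    rwa [show -1 - (j - 1) = -j by abel, show -1 - j = -j - 1 by abel, add_comm]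
  · have := h.2 (fun j => m (-1 - j)) fun j => by
      have := hm (-j)
      simp only [edgeDeg, neg_neg] at this ⊢
      rwa [show -1 - (j - 1) = -j by abel, show -1 - j = -j - 1 by abel, add_comm]
    rw [e] at this
    rwa [e]

/-- A unit of degree can be moved from `0` to `ρ`, whenever two optimal multisets of edges
witness that this is called for by the strong exchange property. -/
def SwapAt {n : ℕ} [NeZero n] (ρ : Fin n) : Prop :=
  ∀ c a b : Fin n → ℕ, IsOpt c a → IsOpt c b → edgeDeg b 0 < edgeDeg a 0 →
    edgeDeg a ρ < edgeDeg b ρ → ∃ m, ∀ j, edgeDeg m j = exch (edgeDeg a) 0 ρ j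

theorem SwapAt.neg {n : ℕ} [NeZero n] {ρ : Fin n} (h : SwapAt ρ) : SwapAt (-ρ) := by
  intro c a b ha hb h0 h1
  have e : ∀ (m : Fin n → ℕ) j, edgeDeg (fun j => m (-1 - j)) j = edgeDeg m (-j) := by
    intro m j
    simp only [edgeDeg]
    rw [show -1 - (j - 1) = -j by abel, show -1 - j = -j - 1 by abel, add_comm]
  obtain ⟨m, hm⟩ := h _ _ _ ha.reflect hb.reflect (by simpa only [e, neg_zero] using h0)
    (by simpa only [e] using h1)
  refine ⟨fun j => m (-1 - j), fun j => ?_⟩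
  rw [e, hm]
  simp only [exch, e, neg_neg, neg_eq_iff_eq_neg, neg_zero]

theorem IsOpt.alternate_3 {c a : Fin 3 → ℕ} (h : IsOpt c a) (i : Fin 3)
    (hi : edgeDeg a i < c i) :
    (a i + a (i + 1) = c (i + 1)) ∧
    (a (i + 1) + a (i + 2) = c (i + 2)) := by
  obtain ⟨h1, h2⟩ := h.shift i
  have e : ∀ x : Fin 3, x + i = i + x := fun x => add_comm _ _
  simp only [edgeDeg, e] at h1 h2 hi
  simp only [Fin.forall_fin_succ] at h1
  rw [show i - 1 = i + 2 by rw [sub_eq_add_neg]; rfl] at hi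
  refine ⟨?_, ?_⟩
  · have := h2 ![a i + 1, a (i + 1), a (i + 2)]
    simp [Fin.forall_fin_succ, Fin.sum_univ_succ] at *
    omega
  · have := h2 ![a i, a (i + 1), a (i + 2) + 1]
    simp [Fin.forall_fin_succ, Fin.sum_univ_succ] at *
    omega

theorem swapAt_3_2 : SwapAt (n := 3) 2 := by
  intro c a b ha hb h0 h1
  have x := ha.alternate_3 2 (h1.trans_le (hb.1 _))
  have y := hb.alternate_3 0 (h0.trans_le (ha.1 _))
  have neg_one : (-1 : Fin 3) = 2 := rfl
  have hA := ha.1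
  have hB := hb.1
  simp [Fin.forall_fin_succ, edgeDeg, neg_one] at h0 h1 hA hB x y
  have p : (0 < a 0) := by grind (splits := 20)
  obtain p0 := p
  refine ⟨![a 0 - 1, a 1 + 1, a 2], ?_⟩
  simp [Fin.forall_fin_succ, edgeDeg, exch, neg_one]
  omega

theorem IsOpt.alternate_4 {c a : Fin 4 → ℕ} (h : IsOpt c a) (i : Fin 4)
    (hi : edgeDeg a i < c i) :
    (a i + a (i + 1) = c (i + 1)) ∧
    (a (i + 1) = 0 ∨ a (i + 2) + a (i + 3) = c (i + 3)) ∧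
    (a (i + 2) + a (i + 3) = c (i + 3)) ∧
    (a (i + 2) = 0 ∨ a i + a (i + 1) = c (i + 1)) := by
  obtain ⟨h1, h2⟩ := h.shift i
  have e : ∀ x : Fin 4, x + i = i + x := fun x => add_comm _ _
  simp only [edgeDeg, e] at h1 h2 hi
  simp only [Fin.forall_fin_succ] at h1
  rw [show i - 1 = i + 3 by rw [sub_eq_add_neg]; rfl] at hi
  refine ⟨?_, ?_, ?_, ?_⟩
  · have := h2 ![a i + 1, a (i + 1), a (i + 2), a (i + 3)]
    simp [Fin.forall_fin_succ, Fin.sum_univ_succ] at *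
    omega
  · have := h2 ![a i + 1, a (i + 1) - 1, a (i + 2) + 1, a (i + 3)]
    simp [Fin.forall_fin_succ, Fin.sum_univ_succ] at *
    omega
  · have := h2 ![a i, a (i + 1), a (i + 2), a (i + 3) + 1]
    simp [Fin.forall_fin_succ, Fin.sum_univ_succ] at *
    omega
  · have := h2 ![a i, a (i + 1) + 1, a (i + 2) - 1, a (i + 3) + 1]
    simp [Fin.forall_fin_succ, Fin.sum_univ_succ] at *
    omega

theorem swapAt_4_1 : SwapAt (n := 4) 1 := by
  intro c a b ha hb h0 h1
  have x := ha.alternate_4 1 (h1.trans_le (hb.1 _))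
  have y := hb.alternate_4 0 (h0.trans_le (ha.1 _))
  have neg_one : (-1 : Fin 4) = 3 := rfl
  have hA := ha.1
  have hB := hb.1
  simp [Fin.forall_fin_succ, edgeDeg, neg_one] at h0 h1 hA hB x y
  grind

theorem swapAt_4_2 : SwapAt (n := 4) 2 := by
  intro c a b ha hb h0 h1
  have x := ha.alternate_4 2 (h1.trans_le (hb.1 _))
  have y := hb.alternate_4 0 (h0.trans_le (ha.1 _))
  have neg_one : (-1 : Fin 4) = 3 := rfl
  have hA := ha.1
  have hB := hb.1
  simp [Fin.forall_fin_succ, edgeDeg, neg_one] at h0 h1 hA hB x y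
  have p : (0 < a 0) ∨ (0 < a 3) := by grind (splits := 20)
  obtain p0 | p3 := p
  · refine ⟨![a 0 - 1, a 1 + 1, a 2, a 3], ?_⟩
    simp [Fin.forall_fin_succ, edgeDeg, exch, neg_one]
    omega
  · refine ⟨![a 0, a 1, a 2 + 1, a 3 - 1], ?_⟩
    simp [Fin.forall_fin_succ, edgeDeg, exch, neg_one]
    omega

theorem IsOpt.alternate_5 {c a : Fin 5 → ℕ} (h : IsOpt c a) (i : Fin 5)
    (hi : edgeDeg a i < c i) :
    (a i + a (i + 1) = c (i + 1)) ∧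
    (a (i + 1) = 0 ∨ a (i + 2) + a (i + 3) = c (i + 3)) ∧
    (a (i + 3) + a (i + 4) = c (i + 4)) ∧
    (a (i + 3) = 0 ∨ a (i + 1) + a (i + 2) = c (i + 2)) := by
  obtain ⟨h1, h2⟩ := h.shift i
  have e : ∀ x : Fin 5, x + i = i + x := fun x => add_comm _ _
  simp only [edgeDeg, e] at h1 h2 hi
  simp only [Fin.forall_fin_succ] at h1
  rw [show i - 1 = i + 4 by rw [sub_eq_add_neg]; rfl] at hi
  refine ⟨?_, ?_, ?_, ?_⟩
  · have := h2 ![a i + 1, a (i + 1), a (i + 2), a (i + 3), a (i + 4)]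
    simp [Fin.forall_fin_succ, Fin.sum_univ_succ] at *
    omega
  · have := h2 ![a i + 1, a (i + 1) - 1, a (i + 2) + 1, a (i + 3), a (i + 4)]
    simp [Fin.forall_fin_succ, Fin.sum_univ_succ] at *
    omega
  · have := h2 ![a i, a (i + 1), a (i + 2), a (i + 3), a (i + 4) + 1]
    simp [Fin.forall_fin_succ, Fin.sum_univ_succ] at *
    omega
  · have := h2 ![a i, a (i + 1), a (i + 2) + 1, a (i + 3) - 1, a (i + 4) + 1]
    simp [Fin.forall_fin_succ, Fin.sum_univ_succ] at *
    omega

theorem swapAt_5_2 : SwapAt (n := 5) 2 := by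
  intro c a b ha hb h0 h1
  have x := ha.alternate_5 2 (h1.trans_le (hb.1 _))
  have y := hb.alternate_5 0 (h0.trans_le (ha.1 _))
  have neg_one : (-1 : Fin 5) = 4 := rfl
  have hA := ha.1
  have hB := hb.1
  simp [Fin.forall_fin_succ, edgeDeg, neg_one] at h0 h1 hA hB x y
  have p : (0 < a 0) := by grind (splits := 20)
  obtain p0 := p
  refine ⟨![a 0 - 1, a 1 + 1, a 2, a 3, a 4], ?_⟩
  simp [Fin.forall_fin_succ, edgeDeg, exch, neg_one]
  omega

theorem swapAt_5_4 : SwapAt (n := 5) 4 := by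
  intro c a b ha hb h0 h1
  have x := ha.alternate_5 4 (h1.trans_le (hb.1 _))
  have y := hb.alternate_5 0 (h0.trans_le (ha.1 _))
  have neg_one : (-1 : Fin 5) = 4 := rfl
  have hA := ha.1
  have hB := hb.1
  simp [Fin.forall_fin_succ, edgeDeg, neg_one] at h0 h1 hA hB x y
  have p : (0 < a 0 ∧ 0 < a 2) := by grind (splits := 20)
  obtain ⟨p0, p2⟩ := p
  refine ⟨![a 0 - 1, a 1 + 1, a 2 - 1, a 3 + 1, a 4], ?_⟩
  simp [Fin.forall_fin_succ, edgeDeg, exch, neg_one]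
  omega

theorem IsOpt.alternate_6 {c a : Fin 6 → ℕ} (h : IsOpt c a) (i : Fin 6)
    (hi : edgeDeg a i < c i) :
    (a i + a (i + 1) = c (i + 1)) ∧
    (a (i + 1) = 0 ∨ a (i + 2) + a (i + 3) = c (i + 3)) ∧
    (a (i + 1) = 0 ∨ a (i + 3) = 0 ∨ a (i + 4) + a (i + 5) = c (i + 5)) ∧
    (a (i + 4) + a (i + 5) = c (i + 5)) ∧
    (a (i + 4) = 0 ∨ a (i + 2) + a (i + 3) = c (i + 3)) ∧
    (a (i + 4) = 0 ∨ a (i + 2) = 0 ∨ a i + a (i + 1) = c (i + 1)) := by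
  obtain ⟨h1, h2⟩ := h.shift i
  have e : ∀ x : Fin 6, x + i = i + x := fun x => add_comm _ _
  simp only [edgeDeg, e] at h1 h2 hi
  simp only [Fin.forall_fin_succ] at h1
  rw [show i - 1 = i + 5 by rw [sub_eq_add_neg]; rfl] at hi
  refine ⟨?_, ?_, ?_, ?_, ?_, ?_⟩
  · have := h2 ![a i + 1, a (i + 1), a (i + 2), a (i + 3), a (i + 4), a (i + 5)]
    simp [Fin.forall_fin_succ, Fin.sum_univ_succ] at *
    omega
  · have := h2 ![a i + 1, a (i + 1) - 1, a (i + 2) + 1, a (i + 3), a (i + 4), a (i + 5)]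
    simp [Fin.forall_fin_succ, Fin.sum_univ_succ] at *
    omega
  · have := h2 ![a i + 1, a (i + 1) - 1, a (i + 2) + 1, a (i + 3) - 1, a (i + 4) + 1, a (i + 5)]
    simp [Fin.forall_fin_succ, Fin.sum_univ_succ] at *
    omega
  · have := h2 ![a i, a (i + 1), a (i + 2), a (i + 3), a (i + 4), a (i + 5) + 1]
    simp [Fin.forall_fin_succ, Fin.sum_univ_succ] at *
    omega
  · have := h2 ![a i, a (i + 1), a (i + 2), a (i + 3) + 1, a (i + 4) - 1, a (i + 5) + 1]
    simp [Fin.forall_fin_succ, Fin.sum_univ_succ] at *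
    omega
  · have := h2 ![a i, a (i + 1) + 1, a (i + 2) - 1, a (i + 3) + 1, a (i + 4) - 1, a (i + 5) + 1]
    simp [Fin.forall_fin_succ, Fin.sum_univ_succ] at *
    omega

theorem swapAt_6_1 : SwapAt (n := 6) 1 := by
  intro c a b ha hb h0 h1
  have x := ha.alternate_6 1 (h1.trans_le (hb.1 _))
  have y := hb.alternate_6 0 (h0.trans_le (ha.1 _))
  have neg_one : (-1 : Fin 6) = 5 := rfl
  have hA := ha.1
  have hB := hb.1
  simp [Fin.forall_fin_succ, edgeDeg, neg_one] at h0 h1 hA hB x y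
  grind

theorem swapAt_6_2 : SwapAt (n := 6) 2 := by
  intro c a b ha hb h0 h1
  have x := ha.alternate_6 2 (h1.trans_le (hb.1 _))
  have y := hb.alternate_6 0 (h0.trans_le (ha.1 _))
  have neg_one : (-1 : Fin 6) = 5 := rfl
  have hA := ha.1
  have hB := hb.1
  simp [Fin.forall_fin_succ, edgeDeg, neg_one] at h0 h1 hA hB x y
  have p : (0 < a 0) ∨ (0 < a 5 ∧ 0 < a 3) := by grind (splits := 20)
  obtain p0 | ⟨p5, p3⟩ := p
  · refine ⟨![a 0 - 1, a 1 + 1, a 2, a 3, a 4, a 5], ?_⟩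
    simp [Fin.forall_fin_succ, edgeDeg, exch, neg_one]
    omega
  · refine ⟨![a 0, a 1, a 2 + 1, a 3 - 1, a 4 + 1, a 5 - 1], ?_⟩
    simp [Fin.forall_fin_succ, edgeDeg, exch, neg_one]
    omega

theorem swapAt_6_3 : SwapAt (n := 6) 3 := by
  intro c a b ha hb h0 h1
  have x := ha.alternate_6 3 (h1.trans_le (hb.1 _))
  have y := hb.alternate_6 0 (h0.trans_le (ha.1 _))
  have neg_one : (-1 : Fin 6) = 5 := rfl
  have hA := ha.1
  have hB := hb.1
  simp [Fin.forall_fin_succ, edgeDeg, neg_one] at h0 h1 hA hB x y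
  grind

theorem IsOpt.alternate_7 {c a : Fin 7 → ℕ} (h : IsOpt c a) (i : Fin 7)
    (hi : edgeDeg a i < c i) :
    (a i + a (i + 1) = c (i + 1)) ∧
    (a (i + 1) = 0 ∨ a (i + 2) + a (i + 3) = c (i + 3)) ∧
    (a (i + 1) = 0 ∨ a (i + 3) = 0 ∨ a (i + 4) + a (i + 5) = c (i + 5)) ∧
    (a (i + 5) + a (i + 6) = c (i + 6)) ∧
    (a (i + 5) = 0 ∨ a (i + 3) + a (i + 4) = c (i + 4)) ∧
    (a (i + 5) = 0 ∨ a (i + 3) = 0 ∨ a (i + 1) + a (i + 2) = c (i + 2)) := by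
  obtain ⟨h1, h2⟩ := h.shift i
  have e : ∀ x : Fin 7, x + i = i + x := fun x => add_comm _ _
  simp only [edgeDeg, e] at h1 h2 hi
  simp only [Fin.forall_fin_succ] at h1
  rw [show i - 1 = i + 6 by rw [sub_eq_add_neg]; rfl] at hi
  refine ⟨?_, ?_, ?_, ?_, ?_, ?_⟩
  · have := h2 ![a i + 1, a (i + 1), a (i + 2), a (i + 3), a (i + 4), a (i + 5), a (i + 6)]
    simp [Fin.forall_fin_succ, Fin.sum_univ_succ] at *
    omega
  · have := h2 ![a i + 1, a (i + 1) - 1, a (i + 2) + 1, a (i + 3), a (i + 4), a (i + 5), a (i + 6)]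
    simp [Fin.forall_fin_succ, Fin.sum_univ_succ] at *
    omega
  · have := h2 ![a i + 1, a (i + 1) - 1, a (i + 2) + 1, a (i + 3) - 1, a (i + 4) + 1, a (i + 5),
      a (i + 6)]
    simp [Fin.forall_fin_succ, Fin.sum_univ_succ] at *
    omega
  · have := h2 ![a i, a (i + 1), a (i + 2), a (i + 3), a (i + 4), a (i + 5), a (i + 6) + 1]
    simp [Fin.forall_fin_succ, Fin.sum_univ_succ] at *
    omega
  · have := h2 ![a i, a (i + 1), a (i + 2), a (i + 3), a (i + 4) + 1, a (i + 5) - 1, a (i + 6) + 1]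
    simp [Fin.forall_fin_succ, Fin.sum_univ_succ] at *
    omega
  · have := h2 ![a i, a (i + 1), a (i + 2) + 1, a (i + 3) - 1, a (i + 4) + 1, a (i + 5) - 1,
      a (i + 6) + 1]
    simp [Fin.forall_fin_succ, Fin.sum_univ_succ] at *
    omega

theorem swapAt_7_2 : SwapAt (n := 7) 2 := by
  intro c a b ha hb h0 h1
  have x := ha.alternate_7 2 (h1.trans_le (hb.1 _))
  have y := hb.alternate_7 0 (h0.trans_le (ha.1 _))
  have neg_one : (-1 : Fin 7) = 6 := rfl
  have hA := ha.1
  have hB := hb.1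
  simp [Fin.forall_fin_succ, edgeDeg, neg_one] at h0 h1 hA hB x y
  have p : (0 < a 0) := by grind (splits := 20)
  obtain p0 := p
  refine ⟨![a 0 - 1, a 1 + 1, a 2, a 3, a 4, a 5, a 6], ?_⟩
  simp [Fin.forall_fin_succ, edgeDeg, exch, neg_one]
  omega

theorem swapAt_7_4 : SwapAt (n := 7) 4 := by
  intro c a b ha hb h0 h1
  have x := ha.alternate_7 4 (h1.trans_le (hb.1 _))
  have y := hb.alternate_7 0 (h0.trans_le (ha.1 _))
  have neg_one : (-1 : Fin 7) = 6 := rfl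
  have hA := ha.1
  have hB := hb.1
  simp [Fin.forall_fin_succ, edgeDeg, neg_one] at h0 h1 hA hB x y
  have p : (0 < a 0 ∧ 0 < a 2) := by grind (splits := 20)
  obtain ⟨p0, p2⟩ := p
  refine ⟨![a 0 - 1, a 1 + 1, a 2 - 1, a 3 + 1, a 4, a 5, a 6], ?_⟩
  simp [Fin.forall_fin_succ, edgeDeg, exch, neg_one]
  omega

theorem swapAt_7_6 : SwapAt (n := 7) 6 := by
  intro c a b ha hb h0 h1
  have x := ha.alternate_7 6 (h1.trans_le (hb.1 _))
  have y := hb.alternate_7 0 (h0.trans_le (ha.1 _))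
  have neg_one : (-1 : Fin 7) = 6 := rfl
  have hA := ha.1
  have hB := hb.1
  simp [Fin.forall_fin_succ, edgeDeg, neg_one] at h0 h1 hA hB x y
  have p : (0 < a 0 ∧ 0 < a 2 ∧ 0 < a 4) := by grind (splits := 20)
  obtain ⟨p0, p2, p4⟩ := p
  refine ⟨![a 0 - 1, a 1 + 1, a 2 - 1, a 3 + 1, a 4 - 1, a 5 + 1, a 6], ?_⟩
  simp [Fin.forall_fin_succ, edgeDeg, exch, neg_one]
  omega

theorem sum_edgeDeg {n : ℕ} [NeZero n] (m : Fin n → ℕ) : ∑ j, edgeDeg m j = 2 * ∑ j, m j := by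
  simp only [edgeDeg, sum_add_distrib]
  rw [show ∑ i, m (i - 1) = ∑ i, m i from Equiv.sum_comp (Equiv.subRight 1) m, two_mul]

theorem cycleG_adj {n : ℕ} [NeZero n] (hn : 3 ≤ n) (i j : Fin n) :
    (cycleG n).Adj i j ↔ i + 1 = j ∨ j + 1 = i := by
  have e : ∀ i j : Fin n, (i.val + 1) % n = j.val ↔ i + 1 = j := by
    intro i j
    rw [Fin.ext_iff, Fin.val_add, Fin.val_one', Nat.mod_eq_of_lt (show 1 < n by omega)]
  have hne : ∀ i : Fin n, i + 1 ≠ i := by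
    intro i h
    have := congrArg Fin.val (add_eq_left.mp h)
    rw [Fin.val_one', Nat.mod_eq_of_lt (show 1 < n by omega)] at this
    simp at this
  simp only [cycleG, SimpleGraph.fromRel_adj, e]
  refine ⟨fun h => h.2, fun h => ⟨?_, h⟩⟩
  rintro rfl
  exact hne _ (h.elim id id)

theorem memPow_cycleG {n : ℕ} [NeZero n] (hn : 3 ≤ n) (q : ℕ) (w : Fin n → ℕ) :
    memPow (cycleG n) q w ↔ ∃ m : Fin n → ℕ, ∑ i, m i = q ∧ ∀ j, edgeDeg m j ≤ w j := by
  constructor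
  · rintro ⟨e, he, hw⟩
    choose f hf using fun k => show ∃ i : Fin n, ∀ j,
        ((if (e k).1 = j then 1 else 0) + (if (e k).2 = j then 1 else 0) : ℕ) =
          (if i = j - 1 then 1 else 0) + (if i = j then 1 else 0) by
      rcases (cycleG_adj hn _ _).1 (he k) with h | h
      · exact ⟨(e k).1, fun j => by rw [← h, add_comm]; simp only [eq_sub_iff_add_eq]⟩
      · exact ⟨(e k).2, fun j => by rw [← h]; simp only [eq_sub_iff_add_eq]⟩
    refine ⟨fun i => ∑ k, if f k = i then 1 else 0, ?_, fun j => ?_⟩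
    · rw [sum_comm]
      simp
    · rw [edgeDeg, ← sum_add_distrib, ← sum_congr rfl fun k _ => hf k j]
      exact hw j
  · rintro ⟨m, rfl, hm⟩
    refine ⟨fun k => ((finSigmaFinEquiv.symm k).1, (finSigmaFinEquiv.symm k).1 + 1),
      fun k => (cycleG_adj hn _ _).2 (Or.inl rfl), fun j => le_trans (le_of_eq ?_) (hm j)⟩
    rw [finSigmaFinEquiv.symm.sum_comp
      (fun p : (i : Fin n) × Fin (m i) =>
        ((if p.1 = j then 1 else 0) + (if p.1 + 1 = j then 1 else 0) : ℕ)),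
      Fintype.sum_sigma]
    simp only [sum_add_distrib, ← eq_sub_iff_add_eq]
    rw [Fintype.sum_eq_single j fun x hx => by simp [hx],
      Fintype.sum_eq_single (j - 1) fun x hx => by simp [hx]]
    simp [edgeDeg, add_comm]

theorem mem_genW_cycleG {n : ℕ} [NeZero n] (hn : 3 ≤ n) (c w : Fin n → ℕ) :
    w ∈ genW (cycleG n) c ↔ ∃ m, IsOpt c m ∧ ∀ j, edgeDeg m j = w j := by
  have hS : {q | ∃ a, bdd c a ∧ memPow (cycleG n) q a} =
      {q | ∃ m : Fin n → ℕ, ∑ i, m i = q ∧ ∀ j, edgeDeg m j ≤ c j} := by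
    ext q
    simp only [memPow_cycleG hn, Set.mem_ofPred_eq]
    constructor
    · rintro ⟨a, ha, m, hm, h⟩
      exact ⟨m, hm, fun j => (h j).trans (ha j)⟩
    · rintro ⟨m, hm, h⟩
      exact ⟨c, fun _ => le_rfl, m, hm, h⟩
  have hδ : ∀ m, IsOpt c m → deltaC (cycleG n) c = ∑ i, m i := by
    intro m hm
    rw [deltaC, hS]
    refine IsGreatest.csSup_eq ⟨⟨m, rfl, hm.1⟩, ?_⟩
    rintro q ⟨m', rfl, h⟩
    exact hm.2 m' h
  have hbdd : BddAbove {q | ∃ m : Fin n → ℕ, ∑ i, m i = q ∧ ∀ j, edgeDeg m j ≤ c j} := by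
    refine ⟨∑ j, c j, ?_⟩
    rintro q ⟨m, rfl, h⟩
    have := sum_le_sum fun j (_ : j ∈ univ) => h j
    rw [sum_edgeDeg] at this
    omega
  constructor
  · rintro ⟨hw, hm, hmin⟩
    obtain ⟨m, hm, h⟩ := (memPow_cycleG hn _ _).1 hm
    have e := hmin (edgeDeg m) h ((memPow_cycleG hn _ _).2 ⟨m, hm, fun _ => le_rfl⟩)
    refine ⟨m, ⟨fun j => (h j).trans (hw j), fun m' h' => ?_⟩, fun j => congrFun e j⟩
    rw [hm, deltaC, hS]
    exact le_csSup hbdd ⟨m', rfl, h'⟩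
  · rintro ⟨m, hm, h⟩
    obtain rfl : edgeDeg m = w := funext h
    refine ⟨hm.1, (memPow_cycleG hn _ _).2 ⟨m, (hδ m hm).symm, fun _ => le_rfl⟩,
      fun b hb hb' => ?_⟩
    obtain ⟨m', hm', h'⟩ := (memPow_cycleG hn _ _).1 hb'
    have h1 := sum_le_sum fun j (_ : j ∈ univ) => h' j
    rw [sum_edgeDeg, hm', hδ m hm, ← sum_edgeDeg] at h1
    exact funext fun j => (sum_eq_sum_iff_of_le fun j _ => hb j).1
      (le_antisymm (sum_le_sum fun j _ => hb j) h1) j (mem_univ j)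

theorem sum_exch {n : ℕ} {u : Fin n → ℕ} {ξ ρ : Fin n} (hξ : 0 < u ξ) (h : ξ ≠ ρ) :
    ∑ j, exch u ξ ρ j = ∑ j, u j := by
  have e : ∀ j, exch u ξ ρ j + (if j = ξ then 1 else 0) = u j + (if j = ρ then 1 else 0) := by
    intro j
    by_cases h1 : j = ρ
    · simp [exch, h1, h.symm]
    · by_cases h2 : j = ξ
      · subst h2
        simp only [exch, h1, if_false, if_true]
        omega
      · simp [exch, h1, h2]
  have := sum_congr rfl fun j (_ : j ∈ univ) => e j
  simpa [sum_add_distrib] using this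

theorem SEP_cycleG_of_swapAt {n : ℕ} [NeZero n] (hn : 3 ≤ n)
    (h : ∀ ρ : Fin n, ρ ≠ 0 → SwapAt ρ) : SEP (cycleG n) := by
  intro c _ u hu v hv ξ ρ hξ hρ
  rw [mem_genW_cycleG hn] at hu hv ⊢
  obtain ⟨a, ha, hau⟩ := hu
  obtain ⟨b, hb, hbv⟩ := hv
  obtain rfl : edgeDeg a = u := funext hau
  obtain rfl : edgeDeg b = v := funext hbv
  have hne : ξ ≠ ρ := by
    rintro rfl
    omega
  have e : ∀ (m : Fin n → ℕ) (k j), edgeDeg (fun j => m (j + k)) j = edgeDeg m (j + k) := by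
    intro m k j
    rw [edgeDeg, edgeDeg, show j + k - 1 = j - 1 + k by abel]
  obtain ⟨m, hm⟩ := h (ρ - ξ) (sub_ne_zero.2 hne.symm) _ _ _ (ha.shift ξ) (hb.shift ξ)
    (by simpa only [e, zero_add] using hξ) (by simpa only [e, sub_add_cancel] using hρ)
  have hm' : ∀ j, edgeDeg (fun j => m (j + -ξ)) j = exch (edgeDeg a) ξ ρ j := by
    intro j
    rw [e, hm]
    simp only [exch, e, ← sub_eq_add_neg, sub_left_inj, sub_eq_zero]
    simp
  refine ⟨_, ⟨fun j => ?_, fun m' h' => (ha.2 m' h').trans (le_of_eq ?_)⟩, hm'⟩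
  · rw [hm', exch]
    have := ha.1 j
    split_ifs with h1 h2
    · subst h1
      exact hρ.trans_le (hb.1 j)
    · omega
    · exact this
  · have h1 := sum_congr rfl fun j (_ : j ∈ univ) => hm' j
    rw [sum_edgeDeg, sum_exch (by omega) hne, sum_edgeDeg] at h1
    omega

theorem swapAt_of_le_seven {n : ℕ} [NeZero n] (hn : 3 ≤ n) (h7 : n ≤ 7) (ρ : Fin n)
    (hρ : ρ ≠ 0) : SwapAt ρ := by
  obtain rfl | rfl | rfl | rfl | rfl : n = 3 ∨ n = 4 ∨ n = 5 ∨ n = 6 ∨ n = 7 := by omega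
  · fin_cases ρ
    exacts [absurd rfl hρ, swapAt_3_2.neg, swapAt_3_2]
  · fin_cases ρ
    exacts [absurd rfl hρ, swapAt_4_1, swapAt_4_2, swapAt_4_1.neg]
  · fin_cases ρ
    exacts [absurd rfl hρ, swapAt_5_4.neg, swapAt_5_2, swapAt_5_2.neg, swapAt_5_4]
  · fin_cases ρ
    exacts [absurd rfl hρ, swapAt_6_1, swapAt_6_2, swapAt_6_3, swapAt_6_2.neg, swapAt_6_1.neg]
  · fin_cases ρ
    exacts [absurd rfl hρ, swapAt_7_6.neg, swapAt_7_2, swapAt_7_4.neg, swapAt_7_4,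
      swapAt_7_2.neg, swapAt_7_6]

/-- Weak linear programming duality: a complementary cover `y` certifies optimality. -/
theorem IsOpt.of_cover {n : ℕ} [NeZero n] {c a : Fin n → ℕ} (y : Fin n → ℕ)
    (hy : ∀ j, 2 ≤ y j + y (j + 1)) (ha : ∀ j, edgeDeg a j ≤ c j)
    (hay : ∀ j, 0 < a j → y j + y (j + 1) = 2) (hya : ∀ j, 0 < y j → edgeDeg a j = c j) :
    IsOpt c a := by
  have e : ∀ m : Fin n → ℕ, ∑ j, y j * edgeDeg m j = ∑ j, m j * (y j + y (j + 1)) := by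
    intro m
    simp only [edgeDeg, mul_add, sum_add_distrib]
    rw [← Equiv.sum_comp (Equiv.addRight (1 : Fin n)) fun j => y j * m (j - 1)]
    simp only [Equiv.coe_addRight, add_sub_cancel_right]
    rw [add_comm]
    simp only [mul_comm]
  refine ⟨ha, fun m hm => ?_⟩
  have h1 : ∑ j, m j * 2 ≤ ∑ j, m j * (y j + y (j + 1)) :=
    sum_le_sum fun j _ => Nat.mul_le_mul_left _ (hy j)
  have h2 : ∑ j, y j * edgeDeg m j ≤ ∑ j, y j * edgeDeg a j := by
    refine sum_le_sum fun j _ => ?_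
    rcases Nat.eq_zero_or_pos (y j) with h | h
    · simp [h]
    · rw [hya j h]
      exact Nat.mul_le_mul_left _ (hm j)
  have h3 : ∑ j, a j * (y j + y (j + 1)) = ∑ j, a j * 2 := by
    refine sum_congr rfl fun j _ => ?_
    rcases Nat.eq_zero_or_pos (a j) with h | h
    · simp [h]
    · rw [hay j h]
  rw [e, e, h3] at h2
  have := h1.trans h2
  rw [← sum_mul, ← sum_mul] at this
  omega

theorem edgeDeg_val {n : ℕ} [NeZero n] (hn : 2 ≤ n) (f : ℕ → ℕ) (j : Fin n) :
    edgeDeg (fun i : Fin n => f i.val) j =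
      f (if j.val = 0 then n - 1 else j.val - 1) + f j.val := by
  have hj : (j - 1).val = if j.val = 0 then n - 1 else j.val - 1 := by
    have h := j.isLt
    have h1 : (1 : Fin n).val = 1 := by rw [Fin.val_one', Nat.mod_eq_of_lt hn]
    rw [Fin.val_sub, h1]
    split_ifs with h0
    · rw [h0, add_zero, Nat.mod_eq_of_lt (by omega)]
    · rw [show n - 1 + j.val = j.val - 1 + n by omega, Nat.add_mod_right,
        Nat.mod_eq_of_lt (by omega)]
  rw [edgeDeg, hj]

theorem val_add_one_eq_ite {n : ℕ} [NeZero n] (hn : 2 ≤ n) (j : Fin n) :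
    (j + 1).val = if j.val = n - 1 then 0 else j.val + 1 := by
  have h := j.isLt
  rw [Fin.val_add, Fin.val_one', Nat.mod_eq_of_lt hn]
  split_ifs with h0
  · rw [h0, Nat.sub_add_cancel (by omega), Nat.mod_self]
  · exact Nat.mod_eq_of_lt (by omega)

/-- `y` is a complementary cover certifying the optimality of `a`, with all data given by
functions on `ℕ`. -/
def Certifies (n : ℕ) (c a y : ℕ → ℕ) : Prop :=
  ∀ i j k, j < n → (j = 0 ∧ i = n - 1 ∨ j = i + 1) → (j = n - 1 ∧ k = 0 ∨ k = j + 1 ∧ k < n) →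
    2 ≤ y j + y k ∧ a i + a j ≤ c j ∧ (0 < a j → y j + y k = 2) ∧ (0 < y j → a i + a j = c j)

theorem Certifies.isOpt {n : ℕ} [NeZero n] (hn : 2 ≤ n) {c a y : ℕ → ℕ}
    (h : Certifies n c a y) : IsOpt (fun j : Fin n => c j.val) (fun j : Fin n => a j.val) := by
  have H := fun j : Fin n => h (if j.val = 0 then n - 1 else j.val - 1) j.val
    (if j.val = n - 1 then 0 else j.val + 1) j.isLt (by split_ifs <;> omega)
    (by split_ifs <;> omega)
  refine IsOpt.of_cover (fun j => y j.val) (fun j => ?_) (fun j => ?_) (fun j => ?_) fun j => ?_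
  · simpa only [val_add_one_eq_ite hn] using (H j).1
  · simpa only [edgeDeg_val hn] using (H j).2.1
  · simpa only [val_add_one_eq_ite hn] using (H j).2.2.1
  · simpa only [edgeDeg_val hn] using (H j).2.2.2

/-- A failure of the strong exchange property, with all data given by functions on `ℕ`. -/
theorem not_SEP_cycleG_of_certifies {n : ℕ} [NeZero n] (hn : 3 ≤ n) (c a b y : ℕ → ℕ)
    (hc : ∀ j, 0 < c j) (ha : Certifies n c a y) (hb : Certifies n c b y) (r : ℕ) (hr0 : 0 < r)
    (hr : r < n) (h0 : b (n - 1) + b 0 < a (n - 1) + a 0)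
    (h1 : a (r - 1) + a r < b (r - 1) + b r)
    (H : ∀ m : ℕ → ℕ, m (n - 1) + m 0 = a (n - 1) + a 0 - 1 →
      (∀ j < n - 1, m j + m (j + 1) =
        if j + 1 = r then a j + a (j + 1) + 1 else a j + a (j + 1)) → False) :
    ¬ SEP (cycleG n) := by
  intro hS
  have hn2 : 2 ≤ n := by omega
  have hm := hS (fun j => c j.val) (fun j => hc _) _
    ((mem_genW_cycleG hn _ _).2 ⟨_, ha.isOpt hn2, fun _ => rfl⟩) _
    ((mem_genW_cycleG hn _ _).2 ⟨_, hb.isOpt hn2, fun _ => rfl⟩) ⟨0, by omega⟩ ⟨r, hr⟩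
    (by simpa [edgeDeg_val hn2] using h0) (by simpa [edgeDeg_val hn2, hr0.ne'] using h1)
  obtain ⟨m, -, hm⟩ := (mem_genW_cycleG hn _ _).1 hm
  obtain ⟨m, rfl⟩ : ∃ f : ℕ → ℕ, m = fun i : Fin n => f i.val :=
    ⟨fun k => m (Fin.ofNat n k), funext fun i => by simp⟩
  simp only [exch, edgeDeg_val hn2, Fin.ext_iff] at hm
  refine H m ?_ fun j hj => ?_
  · simpa [hr0.ne] using hm ⟨0, by omega⟩
  · simpa using hm ⟨j + 1, by omega⟩

theorem not_SEP_cycleG_even {n : ℕ} [NeZero n] (hn : 8 ≤ n) (h2 : n % 2 = 0) :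
    ¬ SEP (cycleG n) := by
  refine not_SEP_cycleG_of_certifies (by omega) (fun i => if i % 2 = 1 then 1 else 2)
    (fun i => if i = 1 ∨ i = 3 ∨ i = 4 ∨ (7 ≤ i ∧ i % 2 = 1) then 1 else 0)
    (fun i => if i = 1 ∨ i = 2 ∨ i = 4 ∨ (6 ≤ i ∧ i % 2 = 0) then 1 else 0)
    (fun i => if i % 2 = 1 then 2 else 0) (fun j => ?_) ?_ ?_ 2 (by omega) (by omega) ?_ ?_ ?_
  · grind
  · intro i j k hj hi hk
    refine ⟨?_, ?_, ?_, ?_⟩ <;> dsimp only <;> split_ifs <;> omega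
  · intro i j k hj hi hk
    refine ⟨?_, ?_, ?_, ?_⟩ <;> dsimp only <;> split_ifs <;> omega
  · grind
  · simp
  · intro m h0 h
    have e1 := h 0 (by omega)
    have e2 := h 1 (by omega)
    have e3 := h 2 (by omega)
    have e4 := h 3 (by omega)
    have e5 := h 4 (by omega)
    have e6 := h 5 (by omega)
    simp at e1 e2 e3 e4 e5 e6
    omega

theorem not_SEP_cycleG_odd {n : ℕ} [NeZero n] (hn : 9 ≤ n) (h2 : n % 2 = 1) :
    ¬ SEP (cycleG n) := by
  refine not_SEP_cycleG_of_certifies (by omega)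
    (fun i => if i = 0 ∨ i = 2 ∨ i = 4 ∨ i = 6 then 2 else 1)
    (fun i => if i = 0 ∨ i = 3 ∨ i = 5 ∨ (6 ≤ i ∧ i % 2 = 0) then 1 else 0)
    (fun i => if i = 1 ∨ i = 3 ∨ i = 4 ∨ (6 ≤ i ∧ i % 2 = 0) then 1 else 0)
    (fun i => if i = 0 ∨ i = 2 ∨ i = 4 ∨ i = 6 then 0 else if i < 8 ∨ i = n - 1 then 2 else 1)
    (fun j => ?_) ?_ ?_ 4 (by omega) (by omega) ?_ ?_ ?_
  · grind
  · intro i j k hj hi hk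
    refine ⟨?_, ?_, ?_, ?_⟩ <;> dsimp only <;> split_ifs <;> omega
  · intro i j k hj hi hk
    refine ⟨?_, ?_, ?_, ?_⟩ <;> dsimp only <;> split_ifs <;> omega
  · grind
  · simp
  · intro m h0 h
    have e1 := h 0 (by omega)
    have e2 := h 1 (by omega)
    have e3 := h 2 (by omega)
    have e4 := h 3 (by omega)
    have e5 := h 4 (by omega)
    have e6 := h 5 (by omega)
    have e7 := h 6 (by omega)
    simp at e1 e2 e3 e4 e5 e6 e7
    omega

/-- The cycle `C_n` (`n ≥ 3`) enjoys the strong exchange property iff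
`3 ≤ n ≤ 7`. -/
theorem stmt7 (n : ℕ) (hn : 3 ≤ n) : SEP (cycleG n) ↔ n ≤ 7 := by
  have : NeZero n := ⟨by omega⟩
  refine ⟨fun h => ?_, fun h => SEP_cycleG_of_swapAt hn (swapAt_of_le_seven hn h)⟩
  by_contra! h7
  rcases Nat.mod_two_eq_zero_or_one n with h2 | h2
  · exact not_SEP_cycleG_even (by omega) h2 h
  · exact not_SEP_cycleG_odd (by omega) h2 h
end

section
/- Every tree that enjoys the strong exchange property has at most one vertex of degree at least three. Equivalently, if a tree $G$ has two distinct vertices each of degree at least $3$, then $G$ does not enjoy the strong exchange property. -/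
open Finset

/-- The exponent vector of the product of the edges `{a, f a}` for `a ∈ A`. -/
def starVec {n : ℕ} (A : Finset (Fin n)) (f : Fin n → Fin n) (j : Fin n) : ℕ :=
  (if j ∈ A then 1 else 0) + #{a ∈ A | f a = j}

lemma starVec_eq_sum {n : ℕ} (A : Finset (Fin n)) (f : Fin n → Fin n) (j : Fin n) :
    starVec A f j = ∑ a ∈ A, ((if a = j then 1 else 0) + (if f a = j then 1 else 0)) := by
  simp [starVec, sum_add_distrib]

lemma sum_starVec {n : ℕ} (A : Finset (Fin n)) (f : Fin n → Fin n) (S : Finset (Fin n)) :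
    ∑ j ∈ S, starVec A f j = #(A ∩ S) + #{a ∈ A | f a ∈ S} := by
  simp only [starVec_eq_sum]
  rw [sum_comm]
  simp [sum_add_distrib]

lemma memPow_starVec {n : ℕ} {G : SimpleGraph (Fin n)} {A : Finset (Fin n)} {f : Fin n → Fin n}
    (hf : ∀ a ∈ A, G.Adj a (f a)) : memPow G #A (starVec A f) := by
  refine ⟨fun i => ((A.equivFin.symm i : Fin n), f (A.equivFin.symm i)),
    fun i => hf _ (A.equivFin.symm i).2, fun j => le_of_eq ?_⟩
  rw [starVec_eq_sum, ← sum_coe_sort A]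
  exact Equiv.sum_comp A.equivFin.symm
    (fun a : A => (if (a : Fin n) = j then 1 else 0) + (if f a = j then 1 else 0))

lemma sum_edge_degrees {n q : ℕ} (e : Fin q → Fin n × Fin n) (S : Finset (Fin n)) :
    ∑ j ∈ S, ∑ i, ((if (e i).1 = j then 1 else 0) + (if (e i).2 = j then 1 else 0)) =
      ∑ i, ((if (e i).1 ∈ S then 1 else 0) + (if (e i).2 ∈ S then 1 else 0)) := by
  rw [sum_comm]
  simp [sum_add_distrib]

lemma le_sum_of_memPow {n q : ℕ} {G : SimpleGraph (Fin n)} {a : Fin n → ℕ} (h : memPow G q a) :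
    2 * q ≤ ∑ j, a j := by
  obtain ⟨e, -, hle⟩ := h
  have := sum_le_sum fun j (_ : j ∈ univ) => hle j
  rw [sum_edge_degrees] at this
  simpa [mul_comm] using this

lemma le_sum_cover_of_memPow {n q : ℕ} {G : SimpleGraph (Fin n)} {a : Fin n → ℕ}
    {A : Finset (Fin n)} (hA : ∀ x y, G.Adj x y → x ∈ A ∨ y ∈ A) (h : memPow G q a) :
    q ≤ ∑ j ∈ A, a j := by
  obtain ⟨e, hadj, hle⟩ := h
  have := sum_le_sum fun j (_ : j ∈ A) => hle j
  rw [sum_edge_degrees] at this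
  refine le_trans ?_ this
  calc q = ∑ i : Fin q, 1 := by simp
    _ ≤ _ := sum_le_sum fun i _ => by
      rcases hA _ _ (hadj i) with h | h <;> simp [h]

/-- Capacity one on `A` and ample capacity elsewhere. -/
def coverCap {n : ℕ} (A : Finset (Fin n)) (j : Fin n) : ℕ := if j ∈ A then 1 else n + 1

lemma bdd_starVec {n : ℕ} {A : Finset (Fin n)} {f : Fin n → Fin n} (hf : ∀ a ∈ A, f a ∉ A) :
    bdd (coverCap A) (starVec A f) := by
  intro j
  unfold coverCap starVec
  split_ifs with hj
  · have : #{a ∈ A | f a = j} = 0 := by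
      rw [card_eq_zero, filter_eq_empty_iff]
      rintro a ha rfl
      exact hf a ha hj
    omega
  · have h1 := card_filter_le A (fun a => f a = j)
    have h2 := card_le_univ A
    simp only [Fintype.card_fin] at h2
    omega

lemma deltaC_coverCap {n : ℕ} {G : SimpleGraph (Fin n)} {A : Finset (Fin n)}
    (hA : ∀ x y, G.Adj x y → x ∈ A ∨ y ∈ A) {f : Fin n → Fin n}
    (hf : ∀ a ∈ A, G.Adj a (f a) ∧ f a ∉ A) : deltaC G (coverCap A) = #A := by
  refine IsGreatest.csSup_eq ⟨⟨starVec A f, bdd_starVec fun a ha => (hf a ha).2,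
    memPow_starVec fun a ha => (hf a ha).1⟩, ?_⟩
  rintro q ⟨a, hb, hm⟩
  calc q ≤ ∑ j ∈ A, a j := le_sum_cover_of_memPow hA hm
    _ ≤ ∑ j ∈ A, 1 := sum_le_sum fun j hj => by simpa [coverCap, hj] using hb j
    _ = #A := by simp

lemma starVec_mem_genW {n : ℕ} {G : SimpleGraph (Fin n)} {A : Finset (Fin n)}
    (hA : ∀ x y, G.Adj x y → x ∈ A ∨ y ∈ A) {f : Fin n → Fin n}
    (hf : ∀ a ∈ A, G.Adj a (f a) ∧ f a ∉ A) : starVec A f ∈ genW G (coverCap A) := by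
  refine ⟨bdd_starVec fun a ha => (hf a ha).2, ?_, ?_⟩ <;> rw [deltaC_coverCap hA hf]
  · exact memPow_starVec fun a ha => (hf a ha).1
  · intro b hb hm
    have hsum : ∑ j, starVec A f j = 2 * #A := by rw [sum_starVec]; simp [two_mul]
    have := (sum_eq_sum_iff_of_le fun j (_ : j ∈ univ) => hb j).1
      (le_antisymm (sum_le_sum fun j _ => hb j) (hsum ▸ le_sum_of_memPow hm))
    exact funext fun j => this j (mem_univ j)

/-- If every edge leaving `C \ A` ends in `C ∩ A`, then the exchange from a vertex outside `C`
to a vertex of `C \ A` overloads `C \ A`. -/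
lemma not_SEP_of_cut {n : ℕ} {G : SimpleGraph (Fin n)} {A C : Finset (Fin n)}
    (hA : ∀ x y, G.Adj x y → x ∈ A ∨ y ∈ A)
    (hC : ∀ x y, G.Adj x y → x ∈ C → x ∉ A → y ∈ C ∧ y ∈ A)
    {f g : Fin n → Fin n} (hf : ∀ a ∈ A, G.Adj a (f a) ∧ f a ∉ A)
    (hg : ∀ a ∈ A, G.Adj a (g a) ∧ g a ∉ A) (hfC : ∀ a ∈ A, a ∈ C → f a ∈ C)
    {ξ ρ : Fin n} (hξA : ξ ∉ A) (hξC : ξ ∉ C) (hρA : ρ ∉ A) (hρC : ρ ∈ C)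
    (hξ : starVec A g ξ < starVec A f ξ) (hρ : starVec A f ρ < starVec A g ρ) : ¬ SEP G := by
  intro h
  have hmem := (h (coverCap A) (fun i => by unfold coverCap; split_ifs <;> omega) _
    (starVec_mem_genW hA hf) _ (starVec_mem_genW hA hg) ξ ρ hξ hρ).2.1
  rw [deltaC_coverCap hA hf] at hmem
  have hne : ξ ≠ ρ := fun h => hξC (h ▸ hρC)
  have hw : ∀ i, exch (starVec A f) ξ ρ i + (if ξ = i then 1 else 0) =
      starVec A f i + (if ρ = i then 1 else 0) := by
    intro i
    unfold exch
    split_ifs <;> subst_vars <;> omega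
  have hwS : ∀ S : Finset (Fin n), ∑ i ∈ S, exch (starVec A f) ξ ρ i + (if ξ ∈ S then 1 else 0) =
      ∑ i ∈ S, starVec A f i + (if ρ ∈ S then 1 else 0) := by
    intro S
    simpa [sum_add_distrib] using sum_congr (rfl : S = S) fun i _ => hw i
  obtain ⟨e, hadj, hle⟩ := hmem
  have htot : ∑ i, exch (starVec A f) ξ ρ i = 2 * #A := by
    have := hwS univ
    rw [sum_starVec] at this
    simp at this
    omega
  have heq := (sum_eq_sum_iff_of_le fun j (_ : j ∈ univ) => hle j).1 (by
    rw [sum_edge_degrees, htot]; simp [mul_comm])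
  have hdeg : ∀ S : Finset (Fin n), ∑ i ∈ S, exch (starVec A f) ξ ρ i =
      ∑ i, ((if (e i).1 ∈ S then 1 else 0) + (if (e i).2 ∈ S then 1 else 0)) := by
    intro S
    rw [← sum_edge_degrees]
    exact sum_congr rfl fun j _ => (heq j (mem_univ j)).symm
  have hcut : ∑ i ∈ C \ A, exch (starVec A f) ξ ρ i ≤ ∑ i ∈ C ∩ A, exch (starVec A f) ξ ρ i := by
    rw [hdeg, hdeg]
    refine sum_le_sum fun i _ => ?_
    have h1 := hC _ _ (hadj i)
    have h2 := hC _ _ (hadj i).symm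
    simp only [mem_sdiff, mem_inter]
    split_ifs <;> first | omega | tauto
  have h1 := hwS (C \ A)
  have h2 := hwS (C ∩ A)
  simp only [mem_sdiff, mem_inter, hξA, hξC, hρA, hρC, sum_starVec, if_true, if_false,
    not_false_iff, and_true, and_false] at h1 h2
  have h3 : #{a ∈ A | f a ∈ C ∧ f a ∈ A} = 0 := by
    rw [card_eq_zero, filter_eq_empty_iff]
    exact fun a ha h => (hf a ha).2 h.2
  have h4 : #(A ∩ C) ≤ #{a ∈ A | f a ∈ C ∧ f a ∉ A} := by
    refine card_le_card fun a ha => ?_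
    rw [mem_inter] at ha
    exact mem_filter.2 ⟨ha.1, hfC a ha.1 ha.2, (hf a ha.1).2⟩
  have h5 : A ∩ (C ∩ A) = A ∩ C := by ext; simp; tauto
  rw [h5] at h2
  omega

lemma starVec_lt_starVec {n : ℕ} {A : Finset (Fin n)} {f g : Fin n → Fin n} {a j : Fin n}
    (ha : a ∈ A) (hfa : f a ≠ j) (hga : g a = j) (h : ∀ b, f b = j → g b = j) :
    starVec A f j < starVec A g j := by
  unfold starVec
  refine Nat.add_lt_add_left (card_lt_card ⟨monotone_filter_right _ fun b _ => h b, fun hs => ?_⟩) _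
  exact hfa (mem_filter.1 (hs (mem_filter.2 ⟨ha, hga⟩))).2

/-- A neighbour set with at least three elements contains two distinct elements that avoid a
given one. -/
lemma exists_two_adj_ne {n : ℕ} {G : SimpleGraph (Fin n)} {u : Fin n}
    (hu : 3 ≤ (G.neighborSet u).ncard) (p : Fin n) :
    ∃ x y, x ≠ y ∧ G.Adj u x ∧ G.Adj u y ∧ x ≠ p ∧ y ≠ p := by
  have h : 1 < (G.neighborSet u \ {p}).ncard := by
    have := Set.pred_ncard_le_ncard_sdiff_singleton (G.neighborSet u) p
    omega
  obtain ⟨x, hx, y, hy, hxy⟩ := (Set.one_lt_ncard (Set.toFinite _)).1 h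
  exact ⟨x, y, hxy, hx.1, hy.1, hx.2, hy.2⟩

/-- If a tree `G` has two distinct vertices each of degree at least `3`,
then `G` does not enjoy the strong exchange property. -/
theorem stmt11 (n : ℕ) (G : SimpleGraph (Fin n)) (htree : G.IsTree)
    (u v : Fin n) (huv : u ≠ v)
    (hu : 3 ≤ (G.neighborSet u).ncard) (hv : 3 ≤ (G.neighborSet v).ncard) :
    ¬ SEP G := by
  classical
  obtain ⟨w, hw⟩ := (htree.connected v u).exists_isPath
  cases w with
  | nil => exact absurd rfl huv
  | @cons _ p _ hvp w =>
  rw [SimpleGraph.Walk.cons_isPath_iff] at hw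
  obtain ⟨col⟩ : Nonempty (G.Coloring (Fin 2)) := htree.isAcyclic.isBipartite
  set H := G.deleteEdges {s(v, p)} with hH
  have hHadj : ∀ a b, H.Adj a b ↔ G.Adj a b ∧ ¬ (a = v ∧ b = p ∨ a = p ∧ b = v) := by
    intro a b
    simp [hH, SimpleGraph.deleteEdges_adj]
  have hbridge : ¬ H.Reachable v p :=
    (SimpleGraph.isBridge_iff.1 (SimpleGraph.isAcyclic_iff_forall_adj_isBridge.1
      htree.isAcyclic hvp))
  have hpu : H.Reachable p u := ⟨w.toDeleteEdge _ fun h => hw.2 (w.fst_mem_support_of_mem_edges h)⟩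
  have hvu : ¬ H.Reachable v u := fun h => hbridge (h.trans hpu.symm)
  set C : Finset (Fin n) := {a | H.Reachable v a} with hCdef
  set A : Finset (Fin n) := {a | if a ∈ C then col a = col v else col a = col u} with hAdef
  have memC : ∀ a, a ∈ C ↔ H.Reachable v a := by simp [hCdef]
  have memA : ∀ a, a ∈ A ↔ if a ∈ C then col a = col v else col a = col u := by simp [hAdef]
  have hvC : v ∈ C := (memC v).2 .rfl
  have huC : u ∉ C := fun h => hvu ((memC u).1 h)
  have hpC : p ∉ C := fun h => hbridge ((memC p).1 h)
  have hvA : v ∈ A := (memA v).2 (by simp [hvC])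
  have huA : u ∈ A := (memA u).2 (by simp [huC])
  have hCH : ∀ a b, H.Adj a b → (a ∈ C ↔ b ∈ C) := by
    intro a b hab
    rw [memC, memC]
    exact ⟨fun h => h.trans hab.reachable, fun h => h.trans hab.symm.reachable⟩
  have hAH : ∀ a b, H.Adj a b → (a ∈ A ↔ b ∉ A) := by
    intro a b hab
    have h1 := col.valid ((hHadj a b).1 hab).1
    rw [memA, memA]
    have h2 := hCH a b hab
    by_cases hb : b ∈ C
    · simp only [h2.2 hb, hb, if_true]
      omega
    · simp only [mt h2.1 hb, hb, if_false]
      omega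
  have hcover : ∀ x y, G.Adj x y → x ∈ A ∨ y ∈ A := by
    intro x y hxy
    by_cases h : H.Adj x y
    · have := hAH x y h
      tauto
    · have := mt (fun h' => (hHadj x y).2 ⟨hxy, h'⟩) h
      rcases not_not.1 this with ⟨rfl, -⟩ | ⟨-, rfl⟩
      · exact .inl hvA
      · exact .inr hvA
  have hcut : ∀ x y, G.Adj x y → x ∈ C → x ∉ A → y ∈ C ∧ y ∈ A := by
    intro x y hxy hxC hxA
    have h : H.Adj x y := (hHadj x y).2 ⟨hxy, by
      rintro (⟨rfl, -⟩ | ⟨rfl, -⟩)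
      · exact hxA hvA
      · exact hpC hxC⟩
    exact ⟨(hCH x y h).1 hxC, not_not.1 (mt (hAH x y h).2 hxA)⟩
  obtain ⟨y₁, y₂, hy, hvy₁, hvy₂, hy₁p, hy₂p⟩ := exists_two_adj_ne hv p
  obtain ⟨x₁, x₂, hx, hux₁, hux₂, hx₁v, hx₂v⟩ := exists_two_adj_ne hu v
  have hux : ∀ x, G.Adj u x → x ≠ v → H.Adj u x := fun x h h' => (hHadj u x).2 ⟨h, by tauto⟩
  have hvy : ∀ y, G.Adj v y → y ≠ p → H.Adj v y := fun y h h' =>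
    (hHadj v y).2 ⟨h, by rintro (h1 | h1); exacts [h' h1.2, hvp.ne h1.1]⟩
  have hex : ∀ a, ∃ b, H.Adj a b := by
    intro a
    by_cases hav : H.Reachable v a
    · by_cases h : a = v
      · exact ⟨y₁, h ▸ hvy _ hvy₁ hy₁p⟩
      · obtain ⟨q⟩ := hav.symm
        cases q with
        | nil => exact absurd rfl h
        | cons h' _ => exact ⟨_, h'⟩
    · by_cases hap : a = p
      · by_cases hpu' : p = u
        · exact ⟨x₁, hap ▸ hpu' ▸ hux _ hux₁ hx₁v⟩
        · obtain ⟨q⟩ := hpu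
          cases q with
          | nil => exact absurd rfl hpu'
          | cons h' _ => exact ⟨_, hap ▸ h'⟩
      · have hav' : a ≠ v := fun h => hav (h ▸ .rfl)
        obtain ⟨q⟩ := htree.connected a v
        cases q with
        | nil => exact absurd rfl hav'
        | cons h' _ => exact ⟨_, (hHadj _ _).2 ⟨h', by tauto⟩⟩
  choose φ hφ using hex
  let F : Fin n → Fin n → Fin n → Fin n := fun x y a => if a = u then x else if a = v then y else φ a
  have hF : ∀ x y, H.Adj u x → H.Adj v y → ∀ a, H.Adj a (F x y a) := by
    intro x y hx hy a
    simp only [F]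
    split_ifs with h1 h2
    exacts [h1 ▸ hx, h2 ▸ hy, hφ a]
  have hX₁ := hux _ hux₁ hx₁v
  have hX₂ := hux _ hux₂ hx₂v
  have hY₁ := hvy _ hvy₁ hy₁p
  have hY₂ := hvy _ hvy₂ hy₂p
  have hF₁ := hF _ _ hX₁ hY₁
  have hF₂ := hF _ _ hX₂ hY₂
  have hx₁C : x₁ ∉ C := mt (hCH _ _ hX₁).2 huC
  have hy₂C : y₂ ∈ C := (hCH _ _ hY₂).1 hvC
  have hxy : y₂ ≠ x₁ := fun h => hx₁C (h ▸ hy₂C)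
  refine not_SEP_of_cut hcover hcut
    (fun a ha => ⟨((hHadj _ _).1 (hF₁ a)).1, (hAH _ _ (hF₁ a)).1 ha⟩)
    (fun a ha => ⟨((hHadj _ _).1 (hF₂ a)).1, (hAH _ _ (hF₂ a)).1 ha⟩)
    (fun a _ haC => (hCH _ _ (hF₁ a)).1 haC) ((hAH _ _ hX₁).1 huA) hx₁C
    ((hAH _ _ hY₂).1 hvA) hy₂C
    (starVec_lt_starVec huA (by simp [F, hx.symm]) (by simp [F]) ?_)
    (starVec_lt_starVec hvA (by simp [F, huv.symm, hy]) (by simp [F, huv.symm]) ?_)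
  · intro b
    simp only [F]
    split_ifs
    exacts [fun _ => rfl, fun h => absurd h hxy, id]
  · intro b
    simp only [F]
    split_ifs
    exacts [fun h => absurd h.symm hxy, fun _ => rfl, id]
end
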